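/- arXiv:1804.01074 — 2 statements merged into one kernel-verified Lean document; each statement's English description precedes it below -/
import Mathlib

section
/- Let α ∈ ℝ and H(x,y,p_x,p_y) = p_x² + p_y² + αx on ℝ⁴. Then the function R₁ = (x p_y − y p_x)p_y − (α/4)y² satisfies {H, R₁} = 0. -/
/-- Canonical Poisson bracket on ℝ⁴ with coordinates (x, y, p_x, p_y). -/
noncomputable def poissonBracket (F G : ℝ → ℝ → ℝ → ℝ → ℝ) (x y px py : ℝ) : ℝ :=
    deriv (fun s => F s y px py) x * deriv (fun s => G x y s py) px
  + deriv (fun s => F x s px py) y * deriv (fun s => G x y px s) py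
  - deriv (fun s => F x y s py) px * deriv (fun s => G s y px py) x
  - deriv (fun s => F x y px s) py * deriv (fun s => G x s px py) y

/-- For the linear-potential Hamiltonian `H = p_x² + p_y² + αx`, the function
`R₁ = (x p_y − y p_x) p_y − (α/4) y²` is a constant of motion. -/
theorem linear_potential_R1_constant_of_motion (α : ℝ) :
    ∀ x y px py : ℝ,
      poissonBracket
        (fun x y px py => px^2 + py^2 + α * x)
        (fun x y px py => (x * py - y * px) * py - (α / 4) * y^2)
        x y px py = 0 := by
  intro x y px py
  have key : ∀ (f : ℝ → ℝ) (a b c t : ℝ), (∀ s, f s = a * s^2 + b * s + c) →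
      deriv f t = 2 * a * t + b := by
    intro f a b c t h
    have hf : f = fun s => a * s^2 + b * s + c := funext h
    rw [hf]
    have h1 := ((((hasDerivAt_id' t).pow 2).const_mul a).add
      ((hasDerivAt_id' t).const_mul b)).add_const c
    have h2 : HasDerivAt (fun s : ℝ => a * s^2 + b * s + c) (2 * a * t + b) t := by
      have e : 2 * a * t + b = a * (((2 : ℕ) : ℝ) * t ^ (2 - 1) * 1) + b * 1 := by
        norm_num
        ring
      rw [e]
      exact h1
    exact h2.deriv
  unfold poissonBracket
  rw [key (fun s => px^2 + py^2 + α * s) 0 α (px^2 + py^2) x (fun s => by ring),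
    key (fun s => (x * py - y * s) * py - (α / 4) * y^2) 0 (-(y * py))
      (x * py * py - (α / 4) * y^2) px (fun s => by ring),
    key (fun s => px^2 + py^2 + α * x) 0 0 (px^2 + py^2 + α * x) y (fun s => by ring),
    key (fun s => s^2 + py^2 + α * x) 1 0 (py^2 + α * x) px (fun s => by ring),
    key (fun s => (s * py - y * px) * py - (α / 4) * y^2) 0 (py * py)
      (-(y * px * py) - (α / 4) * y^2) x (fun s => by ring),
    key (fun s => px^2 + s^2 + α * x) 1 0 (px^2 + α * x) py (fun s => by ring),
    key (fun s => (x * py - s * px) * py - (α / 4) * s^2) (-(α / 4)) (-(px * py))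
      (x * py * py) y (fun s => by ring)]
  ring
end

section
/- Let A₁, A₂, B₁, B₂, C₁, C₂, k₂, k₃ ∈ ℝ with A₁ ≠ 0 and A₂ ≠ 0, and consider the position-dependent-mass Hamiltonian H = (B₁ − C₁x)³ p_x² / (2A₁) + (B₂ + C₂y²)³ p_y² / (2A₂) + k₂x + k₃/y² on the open set {y ≠ 0} ⊂ ℝ⁴. Then the function I₁ = (C₁/(2A₁))(B₁ − C₁x)³ p_x² − k₂(B₁ − C₁x) satisfies {H, I₁} = 0, i.e. I₁ is a time-independent first integral. -/
/-- For the position-dependent-mass Hamiltonian with masses `m_x = A₁/(B₁−C₁x)³`,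
`m_y = A₂/(B₂+C₂y²)³` and potential `k₂x + k₃/y²`, the function
`I₁ = (C₁/(2A₁))(B₁ − C₁x)³p_x² − k₂(B₁ − C₁x)` is a time-independent first integral. -/
theorem pdm_linear_isotonic_integral
    (A₁ A₂ B₁ B₂ C₁ C₂ k₂ k₃ : ℝ) (hA₁ : A₁ ≠ 0) (hA₂ : A₂ ≠ 0) :
    ∀ x y px py : ℝ, y ≠ 0 →
      poissonBracket
        (fun x y px py =>
          (B₁ - C₁ * x)^3 * px^2 / (2 * A₁) + (B₂ + C₂ * y^2)^3 * py^2 / (2 * A₂)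
            + k₂ * x + k₃ / y^2)
        (fun x y px py =>
          (C₁ / (2 * A₁)) * (B₁ - C₁ * x)^3 * px^2 - k₂ * (B₁ - C₁ * x))
        x y px py = 0 := by
  intro x y px py _
  simp only [poissonBracket, deriv_const, mul_zero, add_zero, sub_zero]
  have hu : HasDerivAt (fun s : ℝ => B₁ - C₁ * s) (-C₁) x := by
    simpa using ((hasDerivAt_id x).const_mul C₁).const_sub B₁
  have hp : HasDerivAt (fun s : ℝ => s ^ 2) (2 * px) px := by
    simpa using hasDerivAt_pow 2 px
  have h1 := ((((hu.pow 3).mul_const (px ^ 2)).div_const (2 * A₁)).add_const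
    ((B₂ + C₂ * y^2)^3 * py^2 / (2 * A₂))).add ((hasDerivAt_id x).const_mul k₂)
      |>.add_const (k₃ / y^2)
  have h2 := (hp.const_mul ((C₁ / (2 * A₁)) * (B₁ - C₁ * x)^3)).sub_const
    (k₂ * (B₁ - C₁ * x))
  have h3 := ((((hp.const_mul ((B₁ - C₁ * x)^3)).div_const (2 * A₁)).add_const
    ((B₂ + C₂ * y^2)^3 * py^2 / (2 * A₂))).add_const (k₂ * x)).add_const (k₃ / y^2)
  have h4 := (((hu.pow 3).const_mul (C₁ / (2 * A₁))).mul_const (px ^ 2)).sub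
    (hu.const_mul k₂)
  have e1 := h1.deriv
  have e2 := h2.deriv
  have e3 := h3.deriv
  have e4 := h4.deriv
  erw [e1, e2, e3, e4]
  push_cast
  field_simp
  ring
end
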